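/- arXiv:1304.4481 — 2 statements merged into one kernel-verified Lean document; each statement's English description precedes it below -/
import Mathlib

section
/- Let R be a ring, let P be a class of right R-modules closed under isomorphism, arbitrary direct products and direct summands, and let S be the class of left R-modules M whose character module M* belongs to P. If the character module N* belongs to S for every N ∈ P, then S is closed under arbitrary direct products: for any family (A_i)_{i∈I} of modules in S, the product ∏_{i∈I} A_i belongs to S. -/
universe u

open MulOpposite DirectSum

noncomputable section

/-- The additive group `ℚ/ℤ`. -/
abbrev RatCircle : Type := AddCircle (1 : ℚ)

/-- The character group `Hom_ℤ(M, ℚ/ℤ)` of an abelian group `M`. -/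
def Character (M : Type u) [AddCommGroup M] : Type u := M →+ RatCircle

namespace Character

instance instAddCommGroup (M : Type u) [AddCommGroup M] : AddCommGroup (Character M) :=
  inferInstanceAs (AddCommGroup (M →+ RatCircle))

instance instFunLike (M : Type u) [AddCommGroup M] : FunLike (Character M) M RatCircle :=
  inferInstanceAs (FunLike (M →+ RatCircle) M RatCircle)

instance instAddMonoidHomClass (M : Type u) [AddCommGroup M] :
    AddMonoidHomClass (Character M) M RatCircle :=
  inferInstanceAs (AddMonoidHomClass (M →+ RatCircle) M RatCircle)

@[ext] lemma ext {M : Type u} [AddCommGroup M] {f g : Character M}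
    (h : ∀ m, f m = g m) : f = g := DFunLike.ext _ _ h

variable {R : Type u} [Ring R]

/-- If `M` is a left `R`-module then `Character M` is a right `R`-module,
via `(f • r) m = f (r • m)`. -/
instance instSMulRight {M : Type u} [AddCommGroup M] [Module R M] :
    SMul Rᵐᵒᵖ (Character M) where
  smul r f :=
    ((f : M →+ RatCircle).comp (DistribMulAction.toAddMonoidHom M r.unop) : M →+ RatCircle)

lemma smul_right_apply {M : Type u} [AddCommGroup M] [Module R M]
    (r : Rᵐᵒᵖ) (f : Character M) (m : M) : (r • f) m = f (r.unop • m) := rfl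

instance moduleRight {M : Type u} [AddCommGroup M] [Module R M] :
    Module Rᵐᵒᵖ (Character M) where
  one_smul f := ext fun m => by rw [smul_right_apply, unop_one, one_smul]
  mul_smul r s f := ext fun m => by
    rw [smul_right_apply, smul_right_apply, smul_right_apply, unop_mul, mul_smul]
  smul_zero r := ext fun m => rfl
  smul_add r f g := ext fun m => rfl
  add_smul r s f := ext fun m => by
    show f ((r + s).unop • m) = f (r.unop • m) + f (s.unop • m)
    rw [unop_add, add_smul, map_add]
  zero_smul f := ext fun m => by
    show f ((0 : Rᵐᵒᵖ).unop • m) = 0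
    rw [unop_zero, zero_smul, map_zero]

/-- If `M` is a right `R`-module then `Character M` is a left `R`-module,
via `(r • f) m = f (m • r)`. -/
instance instSMulLeft {M : Type u} [AddCommGroup M] [Module Rᵐᵒᵖ M] :
    SMul R (Character M) where
  smul r f :=
    ((f : M →+ RatCircle).comp (DistribMulAction.toAddMonoidHom M (op r)) : M →+ RatCircle)

lemma smul_left_apply {M : Type u} [AddCommGroup M] [Module Rᵐᵒᵖ M]
    (r : R) (f : Character M) (m : M) : (r • f) m = f (op r • m) := rfl

instance moduleLeft {M : Type u} [AddCommGroup M] [Module Rᵐᵒᵖ M] :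
    Module R (Character M) where
  one_smul f := ext fun m => by rw [smul_left_apply, op_one, one_smul]
  mul_smul r s f := ext fun m => by
    rw [smul_left_apply, smul_left_apply, smul_left_apply, op_mul, mul_smul]
  smul_zero r := ext fun m => rfl
  smul_add r f g := ext fun m => rfl
  add_smul r s f := ext fun m => by
    show f (op (r + s) • m) = f (op r • m) + f (op s • m)
    rw [op_add, add_smul, map_add]
  zero_smul f := ext fun m => by
    show f (op (0 : R) • m) = 0
    rw [op_zero, zero_smul, map_zero]

end Character

section Defs

variable (A : Type u) [Ring A]

/-- A pure embedding: an injective linear map such that every finite system of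
linear equations with constants in `L` solvable in `M` is solvable in `L`. -/
def IsPureEmbedding {L M : Type u} [AddCommGroup L] [AddCommGroup M]
    [Module A L] [Module A M] (i : L →ₗ[A] M) : Prop :=
  Function.Injective i ∧
    ∀ (m n : ℕ) (r : Matrix (Fin m) (Fin n) A) (l : Fin m → L),
      (∃ x : Fin n → M, ∀ j, (∑ k, r j k • x k) = i (l j)) →
      ∃ y : Fin n → L, ∀ j, (∑ k, r j k • y k) = l j

/-- A module is pure-injective if every pure embedding out of it splits. -/
def IsPureInjective (N : Type u) [AddCommGroup N] [Module A N] : Prop :=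
  ∀ (M : Type u) [AddCommGroup M] [Module A M] (i : N →ₗ[A] M),
    IsPureEmbedding A i → ∃ π : M →ₗ[A] N, π.comp i = LinearMap.id

/-- `N` is (isomorphic to) a direct summand of `N'`. -/
def IsDirectSummand (N N' : Type u) [AddCommGroup N] [AddCommGroup N']
    [Module A N] [Module A N'] : Prop :=
  ∃ (i : N →ₗ[A] N') (π : N' →ₗ[A] N), π.comp i = LinearMap.id

/-- A module is indecomposable if it is nonzero and is not the internal direct sum
of two nonzero submodules. -/
def IsIndecomposable (N : Type u) [AddCommGroup N] [Module A N] : Prop :=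
  (∃ x : N, x ≠ 0) ∧ ∀ U V : Submodule A N, U ≠ ⊥ → V ≠ ⊥ → ¬ IsCompl U V

/-- An injective module: every linear map from a submodule of a module `B` into `E`
extends to `B`. -/
def IsInjectiveModule (E : Type u) [AddCommGroup E] [Module A E] : Prop :=
  ∀ (B : Type u) [AddCommGroup B] [Module A B] (L : Submodule A B) (g : L →ₗ[A] E),
    ∃ h : B →ₗ[A] E, ∀ x : L, h x = g x

/-- A cogenerator: points of any module are separated by maps into `E`. -/
def IsCogenerator (E : Type u) [AddCommGroup E] [Module A E] : Prop :=
  ∀ (X : Type u) [AddCommGroup X] [Module A X] (x : X), x ≠ 0 →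
    ∃ g : X →ₗ[A] E, g x ≠ 0

/-- A class of modules is closed under (arbitrary) direct products. -/
def ProdClosed (C : ModuleCat.{u} A → Prop) : Prop :=
  ∀ (ι : Type u) (f : ι → ModuleCat.{u} A), (∀ i, C (f i)) →
    C (ModuleCat.of A (∀ i, (f i : Type u)))

/-- A class of modules is closed under modules purely embedding into its members. -/
def PureSubClosed (C : ModuleCat.{u} A → Prop) : Prop :=
  ∀ (N M : ModuleCat.{u} A) (i : N →ₗ[A] M), IsPureEmbedding A i → C M → C N

/-- A class of modules is closed under colimits of directed systems. -/
def DirLimClosed (C : ModuleCat.{u} A → Prop) : Prop :=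
  ∀ (ι : Type u) [Preorder ι] [IsDirected ι (· ≤ ·)] [Nonempty ι] [DecidableEq ι]
    (G : ι → Type u) [∀ i, AddCommGroup (G i)] [∀ i, Module A (G i)]
    (f : ∀ i j, i ≤ j → G i →ₗ[A] G j) [DirectedSystem G (fun i j h => f i j h)],
    (∀ i, C (ModuleCat.of A (G i))) → C (ModuleCat.of A (Module.DirectLimit G f))

/-- A definable subcategory: a class of modules (closed under isomorphism) which is closed
under direct products, colimits of directed systems, and pure submodules. -/
def IsDefinable (C : ModuleCat.{u} A → Prop) : Prop :=
  ProdClosed A C ∧ DirLimClosed A C ∧ PureSubClosed A C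

end Defs

lemma exists_extend_character {A B : Type u} [AddCommGroup A] [AddCommGroup B]
    (h : A →+ B) (e : A →+ RatCircle) (he : h.ker ≤ e.ker) :
    ∃ g : B →+ RatCircle, ∀ a, g (h a) = e a := by
  let h' : A ⧸ h.ker →+ B := QuotientAddGroup.kerLift h
  obtain ⟨g, hg⟩ := CharacterModule.dual_surjective_of_injective (R := ℤ)
    h'.toIntLinearMap (QuotientAddGroup.kerLift_injective h)
    (QuotientAddGroup.lift h.ker e he : A ⧸ h.ker →+ RatCircle)
  exact ⟨g, fun a => DFunLike.congr_fun hg (QuotientAddGroup.mk a)⟩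

lemma exists_character_ne_zero {B : Type u} [AddCommGroup B] (H : AddSubgroup B) {b : B}
    (hb : b ∉ H) : ∃ g : B →+ RatCircle, (∀ x ∈ H, g x = 0) ∧ g b ≠ 0 := by
  obtain ⟨c, hc⟩ := CharacterModule.exists_character_apply_ne_zero_of_ne_zero
    (a := (b : B ⧸ H)) (by simpa [QuotientAddGroup.eq_zero_iff] using hb)
  refine ⟨AddMonoidHom.comp (c : B ⧸ H →+ RatCircle) (QuotientAddGroup.mk' H), fun x hx => ?_, hc⟩
  have h0 : (QuotientAddGroup.mk' H) x = 0 := (QuotientAddGroup.eq_zero_iff x).2 hx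
  exact (congrArg c h0).trans (map_zero c)

/-- A regularized sum: a homomorphism on a product of copies of `ℚ/ℤ` restricting to the
identity on every factor. -/
lemma exists_regularized_sum (ι : Type u) [DecidableEq ι] :
    ∃ ρ : (ι → RatCircle) →+ RatCircle, ∀ i x, ρ (Pi.single i x) = x := by
  obtain ⟨ρ, hρ⟩ := exists_extend_character (A := ι →₀ RatCircle) (B := ι → RatCircle)
    Finsupp.coeFnAddHom (Finsupp.liftAddHom fun _ => AddMonoidHom.id RatCircle) (by
      intro t ht
      have ht' : t = 0 := DFunLike.coe_injective ht
      rw [ht']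
      exact zero_mem _)
  refine ⟨ρ, fun i x => ?_⟩
  have h := hρ (Finsupp.single i x)
  rw [Finsupp.liftAddHom_apply_single] at h
  rw [← Finsupp.single_eq_pi_single]
  exact h

namespace IsPureEmbedding

variable {R : Type u} [Ring R]

lemma exists_finset_solution {X Y : Type u} [AddCommGroup X] [AddCommGroup Y] [Module R X]
    [Module R Y] {f : X →ₗ[R] Y} (hf : IsPureEmbedding R f) {α β : Type u} (J : Finset α)
    (K : Finset β) (r : α → β → R) (l : α → X) (y : β → Y)
    (hy : ∀ j ∈ J, ∑ k ∈ K, r j k • y k = f (l j)) :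
    ∃ x : β → X, ∀ j ∈ J, ∑ k ∈ K, r j k • x k = l j := by
  classical
  obtain ⟨x, hx⟩ := hf.2 J.card K.card
    (fun j k => r (J.equivFin.symm j) (K.equivFin.symm k)) (fun j => l (J.equivFin.symm j))
    ⟨fun k => y (K.equivFin.symm k), fun j => by
      rw [← hy _ (J.equivFin.symm j).2, ← Finset.sum_coe_sort K]
      exact K.equivFin.symm.sum_comp fun k : K => r (J.equivFin.symm j) k • y k⟩
  refine ⟨fun k => if hk : k ∈ K then x (K.equivFin ⟨k, hk⟩) else 0, fun j hj => ?_⟩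
  have h := hx (J.equivFin ⟨j, hj⟩)
  simp only [Equiv.symm_apply_apply] at h
  rw [← h, ← Finset.sum_coe_sort K, ← K.equivFin.sum_comp]
  simp

lemma pi {ι : Type u} {X Y : ι → Type u} [∀ i, AddCommGroup (X i)] [∀ i, AddCommGroup (Y i)]
    [∀ i, Module R (X i)] [∀ i, Module R (Y i)] {f : ∀ i, X i →ₗ[R] Y i}
    (hf : ∀ i, IsPureEmbedding R (f i)) : IsPureEmbedding R (LinearMap.piMap f) := by
  refine ⟨fun a b hab => funext fun i => (hf i).1 (congrFun hab i), ?_⟩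
  rintro m n r l ⟨x, hx⟩
  have key (i : ι) := (hf i).2 m n r (fun j => l j i)
    ⟨fun k => x k i, fun j => by simpa using congrFun (hx j) i⟩
  choose y hy using key
  exact ⟨fun k i => y i k, fun j => funext fun i => by simpa using hy i j⟩

end IsPureEmbedding

namespace Character

variable {R : Type u} [Ring R]

/-- The linear map of right modules dual to a linear map of left modules. -/
def dualMap {X Y : Type u} [AddCommGroup X] [AddCommGroup Y] [Module R X] [Module R Y]
    (f : X →ₗ[R] Y) : Character Y →ₗ[Rᵐᵒᵖ] Character X where
  toFun c := ((c : Y →+ RatCircle).comp f.toAddMonoidHom : X →+ RatCircle)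
  map_add' _ _ := rfl
  map_smul' r c := ext fun x => by
    show c (r.unop • f x) = c (f (r.unop • x))
    rw [f.map_smul]

@[simp] lemma zero_apply {M : Type u} [AddCommGroup M] (m : M) : (0 : Character M) m = 0 := rfl

/-- Evaluation of characters at a fixed element. -/
def applyHom {M : Type u} [AddCommGroup M] (m : M) : Character M →+ RatCircle where
  toFun c := c m
  map_zero' := rfl
  map_add' _ _ := rfl

lemma sum_apply {α M : Type u} [AddCommGroup M] (s : Finset α) (c : α → Character M) (m : M) :
    (∑ j ∈ s, c j) m = ∑ j ∈ s, c j m := map_sum (applyHom m) c s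

/-- The canonical map of a left module to its double dual. -/
def eval (X : Type u) [AddCommGroup X] [Module R X] : X →ₗ[R] Character (Character X) where
  toFun x := (applyHom x : Character X →+ RatCircle)
  map_add' x y := ext fun c => map_add c x y
  map_smul' _ _ := rfl

@[simp] lemma eval_apply (X : Type u) [AddCommGroup X] [Module R X] (x : X) (c : Character X) :
    eval (R := R) X x c = c x := rfl

lemma isPureEmbedding_eval (X : Type u) [AddCommGroup X] [Module R X] :
    IsPureEmbedding R (eval (R := R) X) := by
  classical
  refine ⟨?_, ?_⟩
  · rw [injective_iff_map_eq_zero]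
    intro x hx
    exact CharacterModule.eq_zero_of_character_apply fun c =>
      DFunLike.congr_fun hx (show Character X from (c : X →+ RatCircle))
  rintro m n r l ⟨φ, hφ⟩
  let T : (Fin n → X) →+ (Fin m → X) :=
    { toFun := fun x j => ∑ k, r j k • x k
      map_zero' := by ext; simp
      map_add' := fun x y => by ext; simp [Finset.sum_add_distrib] }
  by_contra hl
  obtain ⟨g, hg, hgl⟩ := exists_character_ne_zero T.range (b := l) (by
    rintro ⟨x, hx⟩
    exact hl ⟨x, fun j => congrFun hx j⟩)
  let c (j : Fin m) : Character X := g.comp (AddMonoidHom.single (fun _ => X) j)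
  have hc (x : Fin m → X) : g x = ∑ j, c j (x j) := by
    conv_lhs => rw [← Finset.univ_sum_single x, map_sum]
    rfl
  have hrel (k : Fin n) : ∑ j, op (r j k) • c j = 0 := by
    ext a
    rw [show (∑ j, op (r j k) • c j) a = ∑ j, c j (r j k • a) from map_sum (applyHom a) _ _]
    have h := hg (T (Pi.single k a)) ⟨_, rfl⟩
    rw [hc] at h
    simpa [T, Pi.single_apply] using h
  apply hgl
  rw [hc]
  calc ∑ j, c j (l j) = ∑ j, ∑ k, φ k (op (r j k) • c j) := by
        refine Finset.sum_congr rfl fun j _ => ?_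
        rw [← eval_apply (R := R), ← hφ j]
        exact map_sum (applyHom (c j)) _ _
    _ = ∑ k, φ k (∑ j, op (r j k) • c j) := by
        rw [Finset.sum_comm]
        exact Finset.sum_congr rfl fun k _ => (map_sum (φ k) _ _).symm
    _ = 0 := by simp [hrel]

/-- The dual of a pure embedding is a split epimorphism. -/
lemma exists_section_dualMap {X Y : Type u} [AddCommGroup X] [AddCommGroup Y] [Module R X]
    [Module R Y] {f : X →ₗ[R] Y} (hf : IsPureEmbedding R f) :
    ∃ s : Character X →ₗ[Rᵐᵒᵖ] Character Y, (dualMap f).comp s = LinearMap.id := by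
  classical
  let Rel := {r : Character X →₀ R // (r.sum fun c a => op a • c) = 0}
  let rel (r : Rel) : Y →+ (Character X →₀ Y) :=
    { toFun := fun y => r.1.mapRange (fun a => a • y) (zero_smul R y)
      map_zero' := by ext; simp
      map_add' := fun y z => by ext; simp }
  let D : (Rel →₀ Y) →+ (Character X →₀ Y) := Finsupp.liftAddHom rel
  let h : (Character X →₀ X) →+ (Character X →₀ Y) ⧸ D.range :=
    (QuotientAddGroup.mk' D.range).comp (Finsupp.mapRange.addMonoidHom f.toAddMonoidHom)
  let e : (Character X →₀ X) →+ RatCircle := Finsupp.liftAddHom fun c => (c : X →+ RatCircle)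
  obtain ⟨g, hg⟩ := exists_extend_character h e (by
    intro t ht
    obtain ⟨w, hw⟩ := (QuotientAddGroup.eq_zero_iff _).1 ht
    have hD (c : Character X) : ∑ r ∈ w.support, r.1 c • w r = f (t c) := by
      have := DFunLike.congr_fun hw c
      simpa [D, rel, Finsupp.sum, Finsupp.finsetSum_apply] using this
    let J : Finset (Character X) := t.support ∪ w.support.biUnion fun r => r.1.support
    obtain ⟨x, hx⟩ := hf.exists_finset_solution J w.support (fun c r => r.1 c) t w
      fun c _ => hD c
    calc e t = ∑ c ∈ J, c (t c) :=
          Finsupp.sum_of_support_subset _ Finset.subset_union_left _ fun c _ => map_zero c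
      _ = ∑ c ∈ J, ∑ r ∈ w.support, c (r.1 c • x r) :=
          Finset.sum_congr rfl fun c hc => by rw [← hx c hc, map_sum]
      _ = ∑ r ∈ w.support, (r.1.sum fun c a => op a • c) (x r) := by
          rw [Finset.sum_comm]
          refine Finset.sum_congr rfl fun r hr => ?_
          rw [Finsupp.sum_of_support_subset r.1 (s := J) ?_ _ fun c _ => ?_, sum_apply]
          · rfl
          · exact (Finset.subset_biUnion_of_mem (fun r : Rel => r.1.support) hr).trans
              Finset.subset_union_right
          · rw [op_zero, zero_smul]
      _ = 0 := Finset.sum_eq_zero fun r _ => by rw [r.2]; rfl)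
  let G : (Character X →₀ Y) →+ RatCircle := g.comp (QuotientAddGroup.mk' D.range)
  have hG (r : Rel) (y : Y) : G (rel r y) = 0 := by
    have : (QuotientAddGroup.mk' D.range) (rel r y) = 0 :=
      (QuotientAddGroup.eq_zero_iff _).2 ⟨Finsupp.single r y, by simp [D]⟩
    rw [AddMonoidHom.comp_apply, this, map_zero]
  let s (c : Character X) : Character Y := G.comp (Finsupp.singleAddHom c)
  have hs_add (c d : Character X) : s (c + d) = s c + s d := by
    ext y
    let r : Rel := ⟨Finsupp.single (c + d) 1 - (Finsupp.single c 1 + Finsupp.single d 1), by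
      rw [Finsupp.sum_sub_index (by simp [sub_smul]),
        Finsupp.sum_add_index' (by simp) (by simp [add_smul])]
      simp⟩
    have hr : rel r y = Finsupp.single (c + d) y - (Finsupp.single c y + Finsupp.single d y) := by
      ext a
      simp [rel, r, sub_smul, add_smul, Finsupp.single_apply]
    have := hG r y
    rw [hr, map_sub, map_add, sub_eq_zero] at this
    exact this
  have hs_smul (a : Rᵐᵒᵖ) (c : Character X) : s (a • c) = a • s c := by
    ext y
    let r : Rel := ⟨Finsupp.single (a • c) 1 - Finsupp.single c a.unop, by
      rw [Finsupp.sum_sub_index (by simp [sub_smul])]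
      simp⟩
    have hr : rel r y = Finsupp.single (a • c) y - Finsupp.single c (a.unop • y) := by
      ext b
      simp [rel, r, sub_smul, Finsupp.single_apply]
    have := hG r y
    rw [hr, map_sub, sub_eq_zero] at this
    exact this
  refine ⟨{ toFun := s, map_add' := hs_add, map_smul' := hs_smul }, ?_⟩
  ext c x
  refine Eq.trans ?_ ((hg (Finsupp.single c x)).trans (Finsupp.liftAddHom_apply_single _ c x))
  exact congrArg G (Finsupp.mapRange_single (f := f) (hf := map_zero f)).symm

/-- The product of the duals of right modules is a direct summand of the dual of their product. -/
lemma isDirectSummand_pi {ι : Type u} (X : ι → Type u) [∀ i, AddCommGroup (X i)]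
    [∀ i, Module Rᵐᵒᵖ (X i)] :
    IsDirectSummand R (∀ i, Character (X i)) (Character (∀ i, X i)) := by
  classical
  obtain ⟨ρ, hρ⟩ := exists_regularized_sum ι
  refine ⟨
    { toFun := fun φ => ρ.comp
        (AddMonoidHom.mk' (fun x i => φ i (x i)) fun x y => funext fun i => map_add (φ i) _ _)
      map_add' := fun φ ψ => ext fun x => map_add ρ (fun i => φ i (x i)) fun i => ψ i (x i)
      map_smul' := fun _ _ => rfl },
    { toFun := fun ψ i => AddMonoidHom.comp (ψ : (∀ i, X i) →+ RatCircle)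
        (AddMonoidHom.single X i)
      map_add' := fun _ _ => rfl
      map_smul' := fun r ψ => funext fun i => ext fun x => ?_ }, ?_⟩
  · show ψ (op r • Pi.single i x) = ψ (Pi.single i (op r • x))
    rw [Pi.single_smul]
  · ext φ i x
    show ρ (fun j => φ j (Pi.single (M := X) i x j)) = φ i x
    rw [← hρ i (φ i x)]
    congr 1
    ext j
    by_cases hj : j = i
    · subst hj; simp
    · simp [hj]

end Character

theorem duals_in_S_implies_S_product_closed
    {R : Type u} [Ring R] (P : ModuleCat.{u} Rᵐᵒᵖ → Prop)
    (hiso : ∀ (N N' : ModuleCat.{u} Rᵐᵒᵖ), P N → ((N : Type u) ≃ₗ[Rᵐᵒᵖ] (N' : Type u)) → P N')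
    (hprod : ProdClosed Rᵐᵒᵖ P)
    (hsummand : ∀ (N N' : ModuleCat.{u} Rᵐᵒᵖ), P N' →
      IsDirectSummand Rᵐᵒᵖ (N : Type u) (N' : Type u) → P N)
    (hdual : ∀ N : ModuleCat.{u} Rᵐᵒᵖ, P N →
      P (ModuleCat.of Rᵐᵒᵖ (Character (Character (N : Type u))))) :
    ∀ (ι : Type u) (A : ι → ModuleCat.{u} R),
      (∀ i, P (ModuleCat.of Rᵐᵒᵖ (Character (A i : Type u)))) →
      P (ModuleCat.of Rᵐᵒᵖ (Character (∀ i, (A i : Type u)))) := by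
  intro ι A hA
  obtain ⟨σ, τ, hτσ⟩ := Character.isDirectSummand_pi (R := R) fun i => Character (A i : Type u)
  let f := LinearMap.piMap fun i => Character.eval (R := R) (A i : Type u)
  obtain ⟨s, hs⟩ := Character.exists_section_dualMap
    (IsPureEmbedding.pi fun i => Character.isPureEmbedding_eval (R := R) (A i : Type u))
  refine hsummand _ _ (hdual _ (hprod ι _ hA))
    ⟨(Character.dualMap τ).comp s, (Character.dualMap f).comp (Character.dualMap σ), ?_⟩
  ext c x
  have h : τ (σ (f x)) = f x := LinearMap.congr_fun hτσ (f x)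
  show s c (τ (σ (f x))) = c x
  rw [h]
  exact DFunLike.congr_fun (LinearMap.congr_fun hs c) x

end
end

section
/- Let k be a commutative Artinian ring and R an Artin k-algebra, i.e. a k-algebra which is finitely generated as a k-module. Let B' be a class of finitely generated right R-modules closed under isomorphism, finite direct sums, direct summands, and homomorphic images (quotient modules). Then the class of right R-modules isomorphic to a pure submodule of a direct product of members of B' is a definable subcategory of right R-modules. -/
universe u

open MulOpposite DirectSum

noncomputable section

section Cogenerator

variable {k : Type u} [CommRing k]

lemma mem_of_essential_of_isMaximal {V : Type u} [AddCommGroup V] [Module k V]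
    {S : Submodule k V} (hS : ∀ x : V, x ≠ 0 → ∃ c : k, c • x ∈ S ∧ c • x ≠ 0)
    {p : Ideal k} (hp : p.IsMaximal) {x : V} (hx : ∀ a ∈ p, a • x = 0) : x ∈ S := by
  by_cases h0 : x = 0
  · simp [h0]
  obtain ⟨c, hc, hc0⟩ := hS x h0
  obtain ⟨d, hd⟩ := hp.exists_inv (x := c) fun h => hc0 (hx c h)
  obtain ⟨b, hb, hdb⟩ := hd
  have : x = d • c • x := by
    rw [smul_smul]
    have h1 := congrArg (· • x) hdb
    simpa [add_smul, hx b hb] using h1.symm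
  rw [this]
  exact S.smul_mem _ hc

/-- An essential extension of a finitely generated module over a commutative Artinian ring is
finitely generated. -/
lemma finite_of_essential [IsArtinianRing k] {V : Type u} [AddCommGroup V] [Module k V]
    {S : Submodule k V} (hS : ∀ x : V, x ≠ 0 → ∃ c : k, c • x ∈ S ∧ c • x ≠ 0) (hfg : S.FG) :
    Module.Finite k V := by
  have key : ∀ Z : Multiset (PrimeSpectrum k),
      (Submodule.torsionBySet k V
        ((Z.map PrimeSpectrum.asIdeal).prod : Ideal k)).FG := by
    intro Z
    induction Z using Multiset.induction with
    | empty =>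
      convert Submodule.fg_bot
      rw [eq_bot_iff]
      intro x hx
      rw [Submodule.mem_torsionBySet_iff] at hx
      simpa using hx ⟨1, by simp⟩
    | cons p Z ih =>
      rw [Multiset.map_cons, Multiset.prod_cons]
      generalize (Z.map PrimeSpectrum.asIdeal).prod = I at ih ⊢
      obtain ⟨s, hs⟩ := (isNoetherianRing_iff_ideal_fg k).1 inferInstance I
      refine Submodule.fg_of_fg_map_of_fg_inf_ker
        (LinearMap.pi fun a : s => a.1 • LinearMap.id : V →ₗ[k] (s → V)) ?_ ?_
      · refine (Submodule.fg_pi fun _ : s => hfg).of_le ?_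
        rintro _ ⟨x, hx, rfl⟩ a -
        refine mem_of_essential_of_isMaximal hS
          (p := p.asIdeal) p.isPrime.isMaximal' fun b hb => ?_
        have := (Submodule.mem_torsionBySet_iff _ _).1 hx
          ⟨b * a.1, Ideal.mul_mem_mul hb (hs ▸ Submodule.subset_span a.2)⟩
        simpa [mul_smul] using this
      · refine ih.of_le ?_
        rintro x ⟨-, hx⟩
        have hle : I ≤ LinearMap.ker (LinearMap.toSpanSingleton k V x) := by
          rw [← hs, Submodule.span_le]
          intro a ha
          simpa using congrFun hx ⟨a, ha⟩
        rw [Submodule.mem_torsionBySet_iff]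
        intro a
        simpa using hle a.2
  obtain ⟨Z, hZ⟩ := PrimeSpectrum.exists_primeSpectrum_prod_le k ⊥
  have := key Z
  rw [le_bot_iff.1 hZ] at this
  refine ⟨?_⟩
  convert this
  rw [eq_comm, eq_top_iff]
  intro x _
  rw [Submodule.mem_torsionBySet_iff]
  rintro ⟨a, rfl⟩
  simp

/-- Over a commutative Artinian ring, a finitely generated module has a finitely generated injective
essential extension. -/
lemma exists_finite_injective_essential [IsArtinianRing k] (S : Type u) [AddCommGroup S]
    [Module k S] [Module.Finite k S] :
    ∃ (E : Type u) (_ : AddCommGroup E) (_ : Module k E) (_ : Module.Injective k E)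
      (_ : Module.Finite k E) (j : S →ₗ[k] E), Function.Injective j ∧
        ∀ x : E, x ≠ 0 → ∃ c : k, c • x ∈ LinearMap.range j ∧ c • x ≠ 0 := by
  obtain ⟨⟨J, hJ, i, hi⟩⟩ := CategoryTheory.EnoughInjectives.presentation (ModuleCat.of k S)
  have hJ' : Module.Injective k J := Module.injective_module_of_injective_object k J
  replace hi : Function.Injective i.hom := (ModuleCat.mono_iff_injective i).1 hi
  set i' : S →ₗ[k] J := i.hom
  obtain ⟨C, hC⟩ := zorn_le₀ {C : Submodule k J | Disjoint C (LinearMap.range i')} (by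
    intro c hc hchain
    refine ⟨sSup c, ?_, fun _ => le_sSup⟩
    exact (hchain.directedOn).disjoint_sSup_left.2 hc)
  have hCd : Disjoint C (LinearMap.range i') := hC.prop
  set j : S →ₗ[k] J ⧸ C := C.mkQ ∘ₗ i'
  have hj : Function.Injective j := by
    rw [← LinearMap.ker_eq_bot, eq_bot_iff]
    intro s hs
    have h1 : i' s ∈ C := by simpa [j] using hs
    have := Submodule.disjoint_def.1 hCd _ h1 ⟨s, rfl⟩
    exact hi (by simpa using this)
  have hess : ∀ x : J ⧸ C, x ≠ 0 → ∃ c : k, c • x ∈ LinearMap.range j ∧ c • x ≠ 0 := by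
    intro x hx
    obtain ⟨x, rfl⟩ := C.mkQ_surjective x
    by_contra! hcon
    have hxC : x ∉ C := fun h => hx (by simpa using h)
    have : Disjoint (C ⊔ Submodule.span k {x}) (LinearMap.range i') := by
      rw [Submodule.disjoint_def]
      rintro y hy ⟨s, rfl⟩
      obtain ⟨u, hu, v, hv, huv⟩ := Submodule.mem_sup.1 hy
      obtain ⟨c, rfl⟩ := Submodule.mem_span_singleton.1 hv
      have h1 : j s = c • C.mkQ x := by
        have : C.mkQ u = 0 := by simpa using hu
        simp only [j, LinearMap.comp_apply, ← huv, map_add, this, map_smul, zero_add]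
      have h2 := hcon c ⟨s, h1⟩
      rw [← h1] at h2
      rw [hj (a₁ := s) (a₂ := 0) (by simpa using h2), map_zero]
    have h3 := hC.le_of_ge this le_sup_left
    exact hxC (h3 (Submodule.mem_sup_right (Submodule.mem_span_singleton_self x)))
  have hfin : Module.Finite k (J ⧸ C) := finite_of_essential hess
    (by rw [LinearMap.range_eq_map]; exact (Module.Finite.fg_top).map j)
  obtain ⟨h, hh⟩ := hJ'.out j hj i'
  have hinj : Function.Injective (C.mkQ ∘ₗ h) := by
    rw [← LinearMap.ker_eq_bot, eq_bot_iff]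
    intro x hx
    by_contra hx0
    obtain ⟨c, ⟨s, hs⟩, hc0⟩ := hess x hx0
    have : j s = 0 := by
      have h1 : (C.mkQ ∘ₗ h) (c • x) = 0 := by
        rw [map_smul, LinearMap.mem_ker.1 hx, smul_zero]
      rwa [← hs, LinearMap.comp_apply, hh] at h1
    exact hc0 (hs ▸ this)
  have hbij := IsArtinian.bijective_of_injective_endomorphism _ hinj
  let e := LinearEquiv.ofBijective _ hbij
  refine ⟨J ⧸ C, inferInstance, inferInstance, ⟨fun X Y _ _ _ _ f hf g => ?_⟩, hfin, j, hj, hess⟩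
  obtain ⟨g', hg'⟩ := hJ'.out f hf (h ∘ₗ g)
  refine ⟨e.symm ∘ₗ C.mkQ ∘ₗ g', fun x => ?_⟩
  rw [LinearMap.comp_apply, LinearMap.comp_apply, hg', LinearEquiv.coe_coe, LinearEquiv.symm_apply_eq]
  rfl

/-- Linear maps into `E` separate points. -/
def IsCogenerating (k : Type u) [CommRing k] (E : Type u) [AddCommGroup E] [Module k E] : Prop :=
  ∀ (V : Type u) [AddCommGroup V] [Module k V] (x : V), x ≠ 0 → ∃ g : V →ₗ[k] E, g x ≠ 0

/-- A submodule can be separated from an element outside it by a map to a cogenerator. -/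
lemma IsCogenerating.exists_le_ker {E : Type u} [AddCommGroup E] [Module k E]
    (hE : IsCogenerating k E) {V : Type u} [AddCommGroup V] [Module k V] (U : Submodule k V)
    {x : V} (hx : x ∉ U) : ∃ g : V →ₗ[k] E, (∀ u ∈ U, g u = 0) ∧ g x ≠ 0 := by
  obtain ⟨g, hg⟩ := hE (V ⧸ U) (U.mkQ x) (by simpa using hx)
  refine ⟨g ∘ₗ U.mkQ, fun u hu => ?_, hg⟩
  rw [LinearMap.comp_apply, Submodule.mkQ_apply, (Submodule.Quotient.mk_eq_zero U).2 hu, map_zero]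

/-- If `Hom(S, E)` has length at most one for simple `S`, then `Hom(-, E)` does not increase
lengths. -/
lemma length_hom_le {E : Type u} [AddCommGroup E] [Module k E]
    (hE : ∀ (S : Type u) [AddCommGroup S] [Module k S] [IsSimpleModule k S],
      Module.length k (S →ₗ[k] E) ≤ 1)
    {V : Type u} [AddCommGroup V] [Module k V] (hV : IsFiniteLength k V) :
    Module.length k (V →ₗ[k] E) ≤ Module.length k V := by
  induction hV with
  | of_subsingleton => simp
  | @of_simple_quotient V _ _ N _ _ ih =>
    let f : (V →ₗ[k] E) →ₗ[k] (N →ₗ[k] E) := LinearMap.lcomp k E N.subtype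
    have h1 := Module.length_eq_add_of_exact N.subtype N.mkQ N.subtype_injective N.mkQ_surjective
      (LinearMap.exact_subtype_mkQ N)
    have h2 := Module.length_eq_add_of_exact (LinearMap.lcomp k E N.mkQ) f.rangeRestrict
      (fun a b hab => LinearMap.ext fun v => by
        obtain ⟨v, rfl⟩ := N.mkQ_surjective v
        exact LinearMap.congr_fun hab v)
      f.surjective_rangeRestrict (fun φ => ⟨fun h => ?_, ?_⟩)
    · rw [h1, h2, Module.length_eq_one k (V ⧸ N), add_comm]
      exact add_le_add
        ((Module.length_le_of_injective _ (Submodule.subtype_injective _)).trans ih) (hE _)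
    · refine ⟨N.liftQ φ fun n hn => ?_, LinearMap.ext fun v => rfl⟩
      exact LinearMap.congr_fun (congrArg Subtype.val h) ⟨n, hn⟩
    · rintro ⟨ψ, rfl⟩
      ext n
      exact (congrArg ψ ((Submodule.Quotient.mk_eq_zero N).2 n.2)).trans (map_zero ψ)

/-- Matlis duality over a commutative Artinian ring. -/
lemma exists_matlis_dual [IsArtinianRing k] :
    ∃ (E : Type u) (_ : AddCommGroup E) (_ : Module k E), Module.Finite k E ∧ IsCogenerating k E ∧
      ∀ (V : Type u) [AddCommGroup V] [Module k V] [Module.Finite k V],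
        Function.Bijective (LinearMap.applyₗ : V →ₗ[k] (V →ₗ[k] E) →ₗ[k] E) := by
  obtain ⟨E, _, _, hinj, hfin, j, hj, hess⟩ :=
    exists_finite_injective_essential (k := k) (∀ p : MaximalSpectrum k, k ⧸ p.asIdeal)
  have hcog : IsCogenerating k E := by
    intro V _ _ x hx
    obtain ⟨p, hp, hle⟩ := Ideal.exists_le_maximal (LinearMap.ker (LinearMap.toSpanSingleton k V x))
      (fun h => hx (by
        have : (1 : k) ∈ LinearMap.ker (LinearMap.toSpanSingleton k V x) := h ▸ Submodule.mem_top
        simpa using this))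
    classical
    let f : (k ⧸ LinearMap.ker (LinearMap.toSpanSingleton k V x)) →ₗ[k] k ⧸ p :=
      Submodule.factor hle
    let g := j ∘ₗ LinearMap.single k (fun p : MaximalSpectrum k => k ⧸ p.asIdeal) ⟨p, hp⟩ ∘ₗ f
    let l := (LinearMap.ker (LinearMap.toSpanSingleton k V x)).liftQ
      (LinearMap.toSpanSingleton k V x) le_rfl
    obtain ⟨h, hh⟩ := hinj.out l (LinearMap.ker_eq_bot.1 (Submodule.ker_liftQ_eq_bot _ _ _ le_rfl)) g
    refine ⟨h, fun h0 => ?_⟩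
    have h1 := hh (Submodule.Quotient.mk 1)
    have h2 : l (Submodule.Quotient.mk 1) = x := by
      simp only [l, Submodule.liftQ_apply, LinearMap.toSpanSingleton_apply, one_smul]
    rw [h2, h0] at h1
    have h3 := hj (h1.symm.trans (map_zero j).symm)
    have h4 := congrFun h3 ⟨p, hp⟩
    have h5 : (1 : k) ∈ p := by
      rw [← Ideal.Quotient.eq_zero_iff_mem]
      simp [f] at h4
    exact hp.ne_top ((Ideal.eq_top_iff_one p).2 h5)
  have hsimple : ∀ (S : Type u) [AddCommGroup S] [Module k S] [IsSimpleModule k S],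
      Module.length k (S →ₗ[k] E) ≤ 1 := by
    intro S _ _ _
    obtain ⟨p, hp, ⟨e⟩⟩ := isSimpleModule_iff_quot_maximal.1 (inferInstance : IsSimpleModule k S)
    let s : S := e.symm (Submodule.Quotient.mk 1)
    have hs : ∀ a ∈ p, a • s = 0 := by
      intro a ha
      rw [← map_smul, ← Submodule.Quotient.mk_smul, map_eq_zero_iff _ e.symm.injective]
      simpa using Ideal.Quotient.eq_zero_iff_mem.2 ha
    have hmem (f : S →ₗ[k] E) : f s ∈ LinearMap.range j :=
      mem_of_essential_of_isMaximal hess hp fun a ha => by rw [← map_smul, hs a ha, map_zero]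
    let ρ : (S →ₗ[k] E) →ₗ[k] k ⧸ p := LinearMap.proj (⟨p, hp⟩ : MaximalSpectrum k) ∘ₗ
      (LinearEquiv.ofInjective j hj).symm.toLinearMap ∘ₗ
        (LinearMap.applyₗ s).codRestrict (LinearMap.range j) hmem
    have hρ : Function.Injective ρ := by
      rw [← LinearMap.ker_eq_bot, eq_bot_iff]
      intro f hf
      obtain ⟨w, hw⟩ := hmem f
      have hw0 : w = 0 := by
        have hwp : w ⟨p, hp⟩ = 0 := by
          have h1 : (LinearEquiv.ofInjective j hj).symm ⟨f s, hmem f⟩ = w := by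
            rw [LinearEquiv.symm_apply_eq]
            exact Subtype.ext hw.symm
          rw [← h1]
          exact hf
        funext q
        by_cases hq : q = ⟨p, hp⟩
        · rw [hq, hwp, Pi.zero_apply]
        have hnle : ¬ p ≤ q.asIdeal := fun hle =>
          hq (MaximalSpectrum.ext (hp.eq_of_le q.isMaximal.ne_top hle).symm)
        obtain ⟨a, ha, haq⟩ := SetLike.not_le_iff_exists.1 hnle
        have haw : a • w = 0 := hj <| by
          rw [map_smul, hw, ← map_smul, hs a ha, map_zero, map_zero]
        have h2 : Ideal.Quotient.mk q.asIdeal a * w q = 0 := by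
          have := congrFun haw q
          rwa [Pi.smul_apply, Algebra.smul_def] at this
        exact (mul_eq_zero.1 h2).resolve_left fun h => haq (Ideal.Quotient.eq_zero_iff_mem.1 h)
      have hfs : f s = 0 := by rw [← hw, hw0, map_zero]
      have hs0 : s ≠ 0 := by
        rw [Ne, map_eq_zero_iff _ e.symm.injective, Submodule.Quotient.mk_eq_zero]
        exact fun h => hp.ne_top ((Ideal.eq_top_iff_one p).2 h)
      rw [Submodule.mem_bot]
      ext v
      obtain ⟨c, rfl⟩ := IsSimpleModule.toSpanSingleton_surjective k hs0 v
      simp [hfs]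
    have := Module.length_le_of_injective ρ hρ
    have hsim : IsSimpleModule k (k ⧸ p) := isSimpleModule_iff_quot_maximal.2 ⟨p, hp, ⟨.refl _ _⟩⟩
    rwa [Module.length_eq_one k (k ⧸ p)] at this
  refine ⟨E, _, _, hfin, hcog, fun V _ _ _ => ?_⟩
  have hVl : IsFiniteLength k V := isFiniteLength_iff_isNoetherian_isArtinian.2
    ⟨inferInstance, inferInstance⟩
  have hle := length_hom_le hsimple hVl
  have hDl : IsFiniteLength k (V →ₗ[k] E) := isFiniteLength_iff_isNoetherian_isArtinian.2
    ⟨inferInstance, inferInstance⟩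
  have hle' := (length_hom_le hsimple hDl).trans hle
  set ev : V →ₗ[k] (V →ₗ[k] E) →ₗ[k] E := LinearMap.applyₗ
  have hev : Function.Injective ev := by
    rw [← LinearMap.ker_eq_bot, eq_bot_iff]
    intro v hv
    by_contra hv0
    obtain ⟨g, hg⟩ := hcog V v hv0
    exact hg (LinearMap.congr_fun (LinearMap.mem_ker.1 hv) g)
  refine ⟨hev, ?_⟩
  rw [← LinearMap.range_eq_top]
  by_contra htop
  have := Submodule.length_lt htop
  rw [← (LinearEquiv.ofInjective ev hev).length_eq] at this
  exact absurd hle' (not_le.2 this)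

end Cogenerator

section Separation

/-- If every map from `N` to a finitely generated module `Y` over an Artin algebra lands in `T`,
then this is witnessed by a system of linear equations which is solvable in every such `N` and
whose solvability in `Y` forces the constants to come from `T`. -/
lemma exists_system_of_notMem (k : Type u) [CommRing k] [IsArtinianRing k] {A : Type u} [Ring A]
    [Algebra k A] [Module.Finite k A] {Y : Type u} [AddCommGroup Y] [Module A Y] [Module.Finite A Y]
    (T : Submodule A Y) {y : Y} (hy : y ∉ T) :
    ∃ (m n : ℕ) (r : Matrix (Fin m) (Fin n) A) (c : Fin m → A),
      (∀ (N : Type u) [AddCommGroup N] [Module A N],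
        (∀ g : N →ₗ[A] Y, LinearMap.range g ≤ T) → ∀ x : N,
          ∃ z : Fin n → N, ∀ j, ∑ l, r j l • z l = c j • x) ∧
      ¬ ∃ z : Fin n → Y, ∀ j, ∑ l, r j l • z l = c j • y := by
  let _ : Module k Y := Module.compHom Y (algebraMap k A)
  have : IsScalarTower k A Y := IsScalarTower.of_algebraMap_smul fun _ _ => rfl
  have : Module.Finite k Y := Module.Finite.trans A Y
  obtain ⟨E, _, _, hfin, hcog, hdual⟩ := exists_matlis_dual (k := k)
  obtain ⟨m, β, hβ⟩ := Module.Finite.exists_fin (R := k) (M := Y →ₗ[k] E)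
  let q : (Fin m → A) →ₗ[k] (Y →ₗ[k] E) :=
    { toFun a := ∑ j, β j ∘ₗ Algebra.lsmul k k Y (a j)
      map_add' a b := by simp [LinearMap.comp_add, Finset.sum_add_distrib]
      map_smul' c a := by simp [LinearMap.comp_smul, Finset.smul_sum] }
  have hq (a : Fin m → A) (v : Y) : q a v = ∑ j, β j (a j • v) := by simp [q]
  have hqs : Function.Surjective q := by
    rw [← LinearMap.range_eq_top, eq_top_iff, ← hβ, Submodule.span_le]
    rintro _ ⟨j, rfl⟩
    refine ⟨Pi.single j 1, LinearMap.ext fun v => ?_⟩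
    rw [hq, Finset.sum_eq_single j (fun i _ hij => by simp [hij]) (by simp)]
    simp
  obtain ⟨n, s, hs⟩ := Submodule.fg_iff_exists_fin_generating_family.1
    (IsNoetherian.noetherian (LinearMap.ker q))
  have hqsl (l : Fin n) : q (s l) = 0 :=
    LinearMap.mem_ker.1 (hs ▸ Submodule.subset_span ⟨l, rfl⟩)
  obtain ⟨α, hαT, hαy⟩ := hcog.exists_le_ker (T.restrictScalars k) (x := y) hy
  obtain ⟨c, hc⟩ := hqs α
  refine ⟨m, n, fun j l => s l j, c, ?_, ?_⟩
  · intro N _ _ hN x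
    let _ : Module k N := Module.compHom N (algebraMap k A)
    have : IsScalarTower k A N := IsScalarTower.of_algebraMap_smul fun _ _ => rfl
    let L : (Fin n → N) →ₗ[k] (Fin m → N) :=
      { toFun z j := ∑ l, s l j • z l
        map_add' z z' := by ext j; simp [Finset.sum_add_distrib]
        map_smul' a z := by
          ext j
          simp only [Pi.smul_apply, RingHom.id_apply, Finset.smul_sum]
          exact Finset.sum_congr rfl fun l _ => smul_comm _ _ _ }
    by_contra hcon
    obtain ⟨θ, hθL, hθ⟩ := hcog.exists_le_ker (LinearMap.range L) (x := fun j => c j • x)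
      fun ⟨z, hz⟩ => hcon ⟨z, fun j => congrFun hz j⟩
    let Θ (w : N) : (Fin m → A) →ₗ[k] E :=
      θ ∘ₗ LinearMap.pi fun j => (LinearMap.toSpanSingleton A N w).restrictScalars k ∘ₗ
        LinearMap.proj j
    have hΘ (w : N) (a : Fin m → A) : Θ w a = θ fun j => a j • w := rfl
    have hΘk (w : N) : LinearMap.ker q ≤ LinearMap.ker (Θ w) := by
      rw [← hs, Submodule.span_le]
      rintro _ ⟨l, rfl⟩
      refine hθL _ ⟨Pi.single l w, funext fun j => ?_⟩
      change ∑ l', s l' j • (Pi.single l w : Fin n → N) l' = s l j • w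
      rw [Finset.sum_eq_single l (fun i _ hij => by simp [hij]) (by simp)]
      simp
    have hex (w : N) : ∃ v : Y, ∀ a, q a v = θ fun j => a j • w := by
      obtain ⟨v, hv⟩ := (hdual Y).2
        ((LinearMap.ker q).liftQ (Θ w) (hΘk w) ∘ₗ (q.quotKerEquivOfSurjective hqs).symm.toLinearMap)
      refine ⟨v, fun a => ?_⟩
      have h1 := LinearMap.congr_fun hv (q a)
      have h2 : (q.quotKerEquivOfSurjective hqs).symm (q a) = Submodule.Quotient.mk a := by
        rw [LinearEquiv.symm_apply_eq]
        rfl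
      rw [LinearMap.comp_apply, LinearEquiv.coe_coe, h2, Submodule.liftQ_apply, hΘ] at h1
      exact h1
    have huniq (v v' : Y) (h : ∀ a, q a v = q a v') : v = v' := (hdual Y).1 <| by
      ext φ
      obtain ⟨a, rfl⟩ := hqs φ
      exact h a
    choose g hg using hex
    let g' : N →ₗ[A] Y :=
      { toFun := g
        map_add' w w' := huniq _ _ fun a => by
          rw [map_add, hg, hg, hg, ← map_add]
          congr 1
          ext j
          simp
        map_smul' b w := huniq _ _ fun a => by
          have h1 : q a (b • g w) = q (fun j => a j * b) (g w) := by simp [hq, mul_smul]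
          rw [RingHom.id_apply, h1, hg, hg]
          congr 1
          ext j
          simp [mul_smul] }
    refine hθ ?_
    rw [← hg x c, hc]
    exact hαT _ (hN g' ⟨x, rfl⟩)
  · rintro ⟨z, hz⟩
    refine hαy ?_
    rw [← hc, hq]
    simp only [← hz, map_sum]
    rw [Finset.sum_comm]
    refine Finset.sum_eq_zero fun l _ => ?_
    rw [← hq, hqsl, LinearMap.zero_apply]

/-- Over an Artin algebra, a system of linear equations which is not solvable in `M` is not
solvable in some finitely generated quotient of `M`. -/
lemma exists_finite_quotient_not_solvable (k : Type u) [CommRing k] [IsArtinianRing k]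
    {A : Type u} [Ring A] [Algebra k A] [Module.Finite k A] {M : Type u} [AddCommGroup M] [Module A M] {m n : ℕ}
    (r : Matrix (Fin m) (Fin n) A) (l : Fin m → M)
    (h : ¬ ∃ x : Fin n → M, ∀ j, ∑ i, r j i • x i = l j) :
    ∃ K : Submodule A M, Module.Finite A (M ⧸ K) ∧
      ¬ ∃ x : Fin n → M ⧸ K, ∀ j, ∑ i, r j i • x i = K.mkQ (l j) := by
  let _ : Module k M := Module.compHom M (algebraMap k A)
  have : IsScalarTower k A M := IsScalarTower.of_algebraMap_smul fun _ _ => rfl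
  obtain ⟨E, _, _, hfin, hcog, -⟩ := exists_matlis_dual (k := k)
  let L : (Fin n → M) →ₗ[k] (Fin m → M) :=
    { toFun z j := ∑ i, r j i • z i
      map_add' z z' := by ext j; simp [Finset.sum_add_distrib]
      map_smul' a z := by
        ext j
        simp only [Pi.smul_apply, RingHom.id_apply, Finset.smul_sum]
        exact Finset.sum_congr rfl fun l _ => smul_comm _ _ _ }
  obtain ⟨χ, hχL, hχ⟩ := hcog.exists_le_ker (LinearMap.range L) (x := l)
    fun ⟨z, hz⟩ => h ⟨z, fun j => congrFun hz j⟩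
  let χ' (j : Fin m) : M →ₗ[k] E := χ ∘ₗ LinearMap.single k (fun _ => M) j
  have hχ' (v : Fin m → M) : χ v = ∑ j, χ' j (v j) := by
    conv_lhs => rw [← Finset.univ_sum_single v]
    simp [χ']
  let F : M →ₗ[k] (Fin m → A →ₗ[k] E) := LinearMap.pi fun j =>
    { toFun w := χ' j ∘ₗ (LinearMap.toSpanSingleton A M w).restrictScalars k
      map_add' w w' := by ext; simp
      map_smul' c w := by ext a; simp [smul_comm a c w] }
  have hF (w : M) (j : Fin m) (a : A) : F w j a = χ' j (a • w) := rfl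
  let K : Submodule A M :=
    { (LinearMap.ker F).toAddSubmonoid with
      smul_mem' := fun b w hw => by
        change F (b • w) = 0
        ext j a
        rw [hF, ← mul_smul, ← hF, LinearMap.mem_ker.1 hw]
        rfl }
  have hK (w : M) : w ∈ K ↔ F w = 0 := Iff.rfl
  refine ⟨K, ?_, ?_⟩
  · have hfinK : Module.Finite k (M ⧸ K) := by
      let F' : (M ⧸ K) →ₗ[k] (Fin m → A →ₗ[k] E) :=
        (K.restrictScalars k).liftQ F fun w hw => hw
      refine Module.Finite.of_injective F' ?_
      rw [← LinearMap.ker_eq_bot, eq_bot_iff]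
      intro w hw
      obtain ⟨w, rfl⟩ := K.mkQ_surjective w
      exact (Submodule.Quotient.mk_eq_zero K).2 hw
    exact Module.Finite.of_restrictScalars_finite k A _
  · rintro ⟨x, hx⟩
    choose z hz using fun i => K.mkQ_surjective (x i)
    refine hχ ?_
    have h1 (j : Fin m) : χ' j (L z j) = χ' j (l j) := by
      have h2 : L z j - l j ∈ K := by
        rw [← Submodule.Quotient.mk_eq_zero, ← Submodule.mkQ_apply, map_sub, sub_eq_zero, ← hx j]
        change K.mkQ (∑ i, r j i • z i) = _
        simp only [map_sum, map_smul, hz]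
      have h3 := hF (L z j - l j) j 1
      rw [(hK _).1 h2, one_smul, map_sub] at h3
      exact sub_eq_zero.1 h3.symm
    rw [hχ', ← Finset.sum_congr rfl fun j _ => h1 j, ← hχ']
    exact hχL _ ⟨z, rfl⟩

end Separation

section Pure

variable {A : Type u} [Ring A]

lemma IsPureEmbedding.comp {L M N : Type u} [AddCommGroup L] [AddCommGroup M] [AddCommGroup N]
    [Module A L] [Module A M] [Module A N] {j : M →ₗ[A] N} {i : L →ₗ[A] M}
    (hj : IsPureEmbedding A j) (hi : IsPureEmbedding A i) : IsPureEmbedding A (j ∘ₗ i) :=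
  ⟨hj.1.comp hi.1, fun m n r l h => hi.2 m n r l (hj.2 m n r _ h)⟩

/-- A linear map reflecting solvability of linear systems is a pure embedding. -/
lemma isPureEmbedding_of_reflects {L M : Type u} [AddCommGroup L] [AddCommGroup M]
    [Module A L] [Module A M] (i : L →ₗ[A] M)
    (h : ∀ (m n : ℕ) (r : Matrix (Fin m) (Fin n) A) (l : Fin m → L),
      (∃ x : Fin n → M, ∀ j, (∑ k, r j k • x k) = i (l j)) →
      ∃ y : Fin n → L, ∀ j, (∑ k, r j k • y k) = l j) : IsPureEmbedding A i := by
  refine ⟨?_, h⟩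
  rw [← LinearMap.ker_eq_bot, eq_bot_iff]
  intro x hx
  obtain ⟨y, hy⟩ := h 1 0 0 (fun _ => x) ⟨0, fun _ => by simp [LinearMap.mem_ker.1 hx]⟩
  simpa using (hy 0).symm

/-- Solutions of a linear system in a product of modules are computed componentwise. -/
lemma exists_solution_pi_iff {ι : Type u} {N : ι → Type u} [∀ i, AddCommGroup (N i)]
    [∀ i, Module A (N i)] {m n : ℕ} (r : Matrix (Fin m) (Fin n) A) (l : Fin m → ∀ i, N i) :
    (∃ x : Fin n → ∀ i, N i, ∀ j, ∑ k, r j k • x k = l j) ↔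
      ∀ i, ∃ x : Fin n → N i, ∀ j, ∑ k, r j k • x k = l j i := by
  constructor
  · rintro ⟨x, hx⟩ i
    exact ⟨fun k => x k i, fun j => by simp [← hx j]⟩
  · intro h
    choose x hx using h
    exact ⟨fun k i => x i k, fun j => funext fun i => by simp [← hx i j]⟩

/-- Over an Artin algebra, if all maps from the `N i` to a finitely generated module `Y` land
in `T`, then so do all maps from pure submodules of `∏ i, N i`. -/
lemma IsPureEmbedding.range_le (k : Type u) [CommRing k] [IsArtinianRing k] [Algebra k A]
    [Module.Finite k A] {M Y : Type u} [AddCommGroup M] [Module A M] [AddCommGroup Y] [Module A Y]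
    [Module.Finite A Y] {T : Submodule A Y} {ι : Type u} {N : ι → Type u}
    [∀ i, AddCommGroup (N i)] [∀ i, Module A (N i)]
    (hN : ∀ i (g : N i →ₗ[A] Y), LinearMap.range g ≤ T) {e : M →ₗ[A] ∀ i, N i}
    (he : IsPureEmbedding A e) (f : M →ₗ[A] Y) : LinearMap.range f ≤ T := by
  rintro _ ⟨x, rfl⟩
  by_contra hx
  obtain ⟨m, n, r, c, h, hY⟩ := exists_system_of_notMem k T hx
  obtain ⟨z, hz⟩ := he.2 m n r (fun j => c j • x) <| (exists_solution_pi_iff r _).2 fun i => by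
    simpa using h (N i) (hN i) (e x i)
  exact hY ⟨fun l => f (z l), fun j => by simp only [← map_smul, ← map_sum, hz]⟩

/-- The canonical map from `M` to the product of its finitely generated quotients. -/
def toFiniteQuotients (A : Type u) [Ring A] (M : Type u) [AddCommGroup M] [Module A M] :
    M →ₗ[A] ∀ K : {K : Submodule A M // Module.Finite A (M ⧸ K)}, M ⧸ K.1 :=
  LinearMap.pi fun K => K.1.mkQ

lemma isPureEmbedding_toFiniteQuotients (k : Type u) [CommRing k] [IsArtinianRing k] [Algebra k A]
    [Module.Finite k A] (M : Type u) [AddCommGroup M] [Module A M] :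
    IsPureEmbedding A (toFiniteQuotients A M) := by
  refine isPureEmbedding_of_reflects _ fun m n r l h => ?_
  by_contra hcon
  obtain ⟨K, hK, h'⟩ := exists_finite_quotient_not_solvable k r l hcon
  exact h' ((exists_solution_pi_iff r _).1 h ⟨K, hK⟩)

/-- A class closed under finite direct sums and quotients has a largest member among the submodules
of a Noetherian module, through which all maps from members of the class factor. -/
lemma exists_largest_submodule (B : ModuleCat.{u} A → Prop)
    (hsum : ∀ (ι : Type u) [Fintype ι] (g : ι → ModuleCat.{u} A),
      (∀ i, B (g i)) → B (ModuleCat.of A (∀ i, (g i : Type u))))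
    (hquot : ∀ (N N' : ModuleCat.{u} A) (f : (N : Type u) →ₗ[A] (N' : Type u)),
      Function.Surjective f → B N → B N')
    (Y : Type u) [AddCommGroup Y] [Module A Y] [IsNoetherian A Y] :
    ∃ T : Submodule A Y, B (ModuleCat.of A T) ∧
      ∀ N : ModuleCat.{u} A, B N → ∀ g : (N : Type u) →ₗ[A] Y, LinearMap.range g ≤ T := by
  have hbot : B (ModuleCat.of A (⊥ : Submodule A Y)) :=
    hquot _ _ (0 : (∀ i : PEmpty.{u + 1}, (PEmpty.elim i : ModuleCat.{u} A)) →ₗ[A]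
      (⊥ : Submodule A Y)) (fun y => ⟨0, Subsingleton.elim _ _⟩)
      (hsum PEmpty.{u + 1} (fun i => PEmpty.elim i) (fun i => PEmpty.elim i))
  obtain ⟨T, hT, hmax⟩ := set_has_maximal_iff_noetherian.2 ‹IsNoetherian A Y›
    {T : Submodule A Y | B (ModuleCat.of A T)} ⟨⊥, hbot⟩
  refine ⟨T, hT, fun N hN g => ?_⟩
  have hsup : B (ModuleCat.of A (T ⊔ LinearMap.range g : Submodule A Y)) := by
    let G : ULift.{u} Bool → ModuleCat.{u} A := fun b => cond b.down (ModuleCat.of A T) N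
    have hG : ∀ b, B (G b) := by
      rintro ⟨_ | _⟩
      · exact hN
      · exact hT
    let p : (∀ b, G b) →ₗ[A] Y :=
      T.subtype ∘ₗ (LinearMap.proj (φ := fun b => (G b : Type u)) ⟨true⟩ : _ →ₗ[A] T) +
        g ∘ₗ (LinearMap.proj (φ := fun b => (G b : Type u)) ⟨false⟩ : _ →ₗ[A] N)
    have hp (v : ∀ b, G b) : p v ∈ T ⊔ LinearMap.range g :=
      Submodule.add_mem_sup (Subtype.prop (p := fun y => y ∈ T) (v ⟨true⟩)) ⟨v ⟨false⟩, rfl⟩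
    refine hquot _ _ (p.codRestrict _ hp) ?_ (hsum _ G hG)
    rintro ⟨y, hy⟩
    obtain ⟨t, ht, _, ⟨w, rfl⟩, rfl⟩ := Submodule.mem_sup.1 hy
    refine ⟨fun b => match b with
      | ⟨true⟩ => (⟨t, ht⟩ : T)
      | ⟨false⟩ => w, Subtype.ext rfl⟩
  have := hmax _ hsup
  exact le_sup_right.trans (not_lt_iff_le_imp_ge.1 this le_sup_left)

end Pure

theorem artin_algebra_quotient_closed_gives_definable
    {k : Type u} [CommRing k] [IsArtinianRing k]
    (R : Type u) [Ring R] [Algebra k R] [Module.Finite k R]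
    (B' : ModuleCat.{u} Rᵐᵒᵖ → Prop)
    (hfg : ∀ N : ModuleCat.{u} Rᵐᵒᵖ, B' N → Module.Finite Rᵐᵒᵖ (N : Type u))
    (hiso : ∀ (N N' : ModuleCat.{u} Rᵐᵒᵖ), B' N → ((N : Type u) ≃ₗ[Rᵐᵒᵖ] (N' : Type u)) → B' N')
    (hsum : ∀ (ι : Type u) [Fintype ι] (g : ι → ModuleCat.{u} Rᵐᵒᵖ),
      (∀ i, B' (g i)) → B' (ModuleCat.of Rᵐᵒᵖ (∀ i, (g i : Type u))))
    (hsummand : ∀ (N N' : ModuleCat.{u} Rᵐᵒᵖ), B' N' →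
      IsDirectSummand Rᵐᵒᵖ (N : Type u) (N' : Type u) → B' N)
    (hquot : ∀ (N N' : ModuleCat.{u} Rᵐᵒᵖ) (f : (N : Type u) →ₗ[Rᵐᵒᵖ] (N' : Type u)),
      Function.Surjective f → B' N → B' N') :
    IsDefinable Rᵐᵒᵖ (fun N : ModuleCat.{u} Rᵐᵒᵖ =>
      ∃ (ι : Type u) (g : ι → ModuleCat.{u} Rᵐᵒᵖ), (∀ i, B' (g i)) ∧
        ∃ emb : (N : Type u) →ₗ[Rᵐᵒᵖ] (∀ i, (g i : Type u)),
          IsPureEmbedding Rᵐᵒᵖ emb) := by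
  have hnoeth : IsNoetherianRing Rᵐᵒᵖ := isNoetherian_of_tower k inferInstance
  refine ⟨?_, ?_, ?_⟩
  · intro ι f hf
    choose κ g hg e he using hf
    refine ⟨Σ i, κ i, fun s => g s.1 s.2, fun s => hg s.1 s.2,
      LinearMap.pi fun s => LinearMap.proj s.2 ∘ₗ e s.1 ∘ₗ LinearMap.proj s.1, ?_⟩
    refine isPureEmbedding_of_reflects _ fun m n r l h => ?_
    rw [exists_solution_pi_iff]
    intro i
    refine (he i).2 m n r _ ?_
    rw [exists_solution_pi_iff]
    exact fun t => (exists_solution_pi_iff r _).1 h ⟨i, t⟩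
  · intro ι _ _ _ _ G _ _ f _ hG
    refine ⟨{K : Submodule Rᵐᵒᵖ (Module.DirectLimit G f) //
        Module.Finite Rᵐᵒᵖ (Module.DirectLimit G f ⧸ K)},
      fun K => ModuleCat.of Rᵐᵒᵖ (Module.DirectLimit G f ⧸ K.1), fun K => ?_,
      toFiniteQuotients Rᵐᵒᵖ _, isPureEmbedding_toFiniteQuotients k _⟩
    obtain ⟨K, hK⟩ := K
    obtain ⟨T, hT, hTmax⟩ := exists_largest_submodule B' hsum hquot (Module.DirectLimit G f ⧸ K)
    refine hquot _ _ T.subtype (fun y => ?_) hT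
    obtain ⟨x, rfl⟩ := K.mkQ_surjective y
    obtain ⟨i, x, rfl⟩ := Module.DirectLimit.exists_of x
    obtain ⟨κ, g, hg, e, he⟩ := hG i
    have hle := he.range_le k (T := T) (fun t => hTmax _ (hg t))
      (K.mkQ ∘ₗ Module.DirectLimit.of Rᵐᵒᵖ ι G f i)
    exact ⟨⟨_, hle ⟨x, rfl⟩⟩, rfl⟩
  · rintro N M i hi ⟨ι, g, hg, e, he⟩
    exact ⟨ι, g, hg, e ∘ₗ i, he.comp hi⟩

end
end
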